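/- There exists a universal constant C > 0 with the following property. For every N ∈ ℕ, every subset X ⊆ ℝ^N containing at least two points, and every ε ∈ (0,1), there exist a natural number m with m ≤ C·ε^{-2}·(w(S_X) + 1)² and a (deterministic) matrix Φ ∈ ℝ^{m×N} that provides ε-convex hull distortion for S_X. -/

import Mathlib

open MeasureTheory ProbabilityTheory
open scoped RealInnerProductSpace

noncomputable def gaussianWidth {N : ℕ} (A : Set (EuclideanSpace ℝ (Fin N))) : ℝ :=
  ∫ g : Fin N → ℝ, sSup ((fun a : EuclideanSpace ℝ (Fin N) => ∑ i, g i * a i) '' A)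
    ∂(Measure.pi fun _ => gaussianReal 0 1)

/-- The set of unit secants of `X`. -/
def unitSecants {N : ℕ} (X : Set (EuclideanSpace ℝ (Fin N))) : Set (EuclideanSpace ℝ (Fin N)) :=
  closure {u | ∃ x ∈ X, ∃ y ∈ X, x ≠ y ∧ u = ‖x - y‖⁻¹ • (x - y)}

/-- The action of an `m × N` matrix on Euclidean space. -/
noncomputable def mulVecE {m N : ℕ} (Φ : Matrix (Fin m) (Fin N) ℝ)
    (x : EuclideanSpace ℝ (Fin N)) : EuclideanSpace ℝ (Fin m) :=
  (EuclideanSpace.equiv (Fin m) ℝ).symm (Φ.mulVec ((EuclideanSpace.equiv (Fin N) ℝ) x))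

/-- `Φ` provides `η`-convex hull distortion for `S`. -/
def convexHullDistortion {m N : ℕ} (Φ : Matrix (Fin m) (Fin N) ℝ) (η : ℝ)
    (S : Set (EuclideanSpace ℝ (Fin N))) : Prop :=
  ∀ x ∈ convexHull ℝ S, |‖mulVecE Φ x‖ - ‖x‖| ≤ η

/-- The law of a family of independent standard normal variables. -/
noncomputable abbrev stdGaussianPi (ι : Type*) [Fintype ι] : Measure (ι → ℝ) :=
  Measure.pi fun _ => gaussianReal 0 1

lemma integrable_id_mul_of_bounded {f : ℝ → ℝ} {C : ℝ} (hf : Continuous f)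
    (hC : ∀ t, |f t| ≤ C) : Integrable (fun t => t * f t) (gaussianReal 0 1) := by
  have h1 : Integrable (fun t : ℝ => t) (gaussianReal 0 1) :=
    (memLp_id_gaussianReal (μ := 0) (v := 1) 1).integrable (by simp)
  exact h1.mul_bdd (c := C) hf.aestronglyMeasurable (ae_of_all _ hC)

lemma integrable_of_bounded {Ω : Type*} [TopologicalSpace Ω] [MeasurableSpace Ω]
    [OpensMeasurableSpace Ω] {μ : Measure Ω} [IsFiniteMeasure μ]
    {f : Ω → ℝ} {C : ℝ} (hf : Continuous f) (hC : ∀ t, |f t| ≤ C) : Integrable f μ :=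
  Integrable.of_bound hf.aestronglyMeasurable C (ae_of_all _ hC)

lemma integrable_gaussianReal_iff {f : ℝ → ℝ} :
    Integrable f (gaussianReal 0 1) ↔ Integrable (fun x => gaussianPDFReal 0 1 x * f x) := by
  rw [gaussianReal_of_var_ne_zero _ one_ne_zero,
    integrable_withDensity_iff_integrable_smul' (measurable_gaussianPDF _ _)
      (ae_of_all _ fun _ => gaussianPDF_lt_top)]
  simp [toReal_gaussianPDF]

/-- Gaussian integration by parts on the line. -/
lemma integral_id_mul_gaussianReal {f f' : ℝ → ℝ} {C C' : ℝ}
    (hf : ∀ t, HasDerivAt f (f' t) t) (hf' : Continuous f')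
    (hC : ∀ t, |f t| ≤ C) (hC' : ∀ t, |f' t| ≤ C') :
    ∫ t, t * f t ∂(gaussianReal 0 1) = ∫ t, f' t ∂(gaussianReal 0 1) := by
  have hcont : Continuous f := continuous_iff_continuousAt.2 fun t => (hf t).continuousAt
  have hpdf : ∀ t : ℝ, HasDerivAt (gaussianPDFReal 0 1) (-t * gaussianPDFReal 0 1 t) t := by
    intro t
    have h : HasDerivAt (fun x : ℝ => -(x - 0) ^ 2 / (2 * ((1 : NNReal) : ℝ))) (-t) t := by
      have := (((hasDerivAt_id t).sub_const 0).pow 2).neg.div_const (2 * ((1 : NNReal) : ℝ))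
      refine this.congr_deriv ?_
      simp; ring
    have h2 := (h.exp).const_mul (√(2 * Real.pi * (1 : NNReal)))⁻¹
    refine h2.congr_deriv ?_
    simp only [gaussianPDFReal]
    ring
  have i1 := integrable_gaussianReal_iff.1 (integrable_id_mul_of_bounded hcont hC)
  have i2 := integrable_gaussianReal_iff.1
    (integrable_of_bounded (μ := gaussianReal 0 1) hf' hC')
  have i3 := integrable_gaussianReal_iff.1
    (integrable_of_bounded (μ := gaussianReal 0 1) hcont hC)
  rw [integral_gaussianReal_eq_integral_smul one_ne_zero,
    integral_gaussianReal_eq_integral_smul one_ne_zero]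
  have := integral_mul_deriv_eq_deriv_mul_of_integrable
    (u := gaussianPDFReal 0 1) (v := f) (u' := fun t => -t * gaussianPDFReal 0 1 t) (v' := f')
    (fun t _ => hpdf t) (fun t _ => hf t) i2
    (by refine i1.neg.congr (ae_of_all _ fun t => ?_); simp; ring) i3
  simp only [smul_eq_mul]
  rw [this, ← integral_neg]
  congr 1; ext t; ring

/-- Resampling one coordinate of a standard Gaussian vector does not change its law. -/
lemma map_update_stdGaussianPi {ι : Type*} [Fintype ι] [DecidableEq ι] (i : ι) :
    ((stdGaussianPi ι).prod (gaussianReal 0 1)).map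
      (fun p : (ι → ℝ) × ℝ => Function.update p.1 i p.2) = stdGaussianPi ι := by
  have hm : Measurable (fun p : (ι → ℝ) × ℝ => Function.update p.1 i p.2) := by
    rw [measurable_pi_iff]
    intro j
    by_cases h : j = i
    · subst h; simpa using measurable_snd
    · simp only [Function.update_of_ne h]; fun_prop
  symm
  refine Measure.pi_eq fun s hs => ?_
  rw [Measure.map_apply hm (MeasurableSet.univ_pi hs)]
  have : (fun p : (ι → ℝ) × ℝ => Function.update p.1 i p.2) ⁻¹' Set.univ.pi s
      = (Set.univ.pi (Function.update s i Set.univ)) ×ˢ s i := by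
    ext ⟨w, t⟩
    simp only [Set.mem_preimage, Set.mem_univ_pi, Set.mem_prod]
    constructor
    · intro h
      refine ⟨fun j => ?_, by simpa using h i⟩
      by_cases hj : j = i
      · subst hj; simp
      · simpa [Function.update_of_ne hj] using h j
    · rintro ⟨h1, h2⟩ j
      by_cases hj : j = i
      · subst hj; simpa using h2
      · simpa [Function.update_of_ne hj] using h1 j
  rw [this, Measure.prod_prod, Measure.pi_pi, ← Finset.mul_prod_erase _ _ (Finset.mem_univ i),
    ← Finset.mul_prod_erase Finset.univ (fun j => gaussianReal 0 1 (s j)) (Finset.mem_univ i)]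
  simp only [Function.update_self, measure_univ, one_mul]
  rw [mul_comm]
  congr 1
  refine Finset.prod_congr rfl fun j hj => ?_
  rw [Function.update_of_ne (Finset.ne_of_mem_erase hj)]

lemma measurePreserving_precomp_stdGaussianPi {ι κ : Type*} [Fintype ι] [Fintype κ] {e : κ → ι}
    (he : Function.Injective e) :
    MeasurePreserving (fun (w : ι → ℝ) j => w (e j)) (stdGaussianPi ι) (stdGaussianPi κ) := by
  refine ⟨by fun_prop, ?_⟩
  have h := (iIndepFun_pi (μ := fun _ : ι => gaussianReal 0 1) (X := fun _ => id)
    (fun _ => aemeasurable_id)).precomp he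
  have h2 := (iIndepFun_iff_map_fun_eq_pi_map fun j => (measurable_pi_apply (e j)).aemeasurable).1 h
  rw [h2]
  congr 1
  ext1 j
  exact (measurePreserving_eval (fun _ : ι => gaussianReal 0 1) (e j)).map_eq

lemma integrable_eval_stdGaussianPi {ι : Type*} [Fintype ι] (i : ι) :
    Integrable (fun w : ι → ℝ => w i) (stdGaussianPi ι) :=
  (measurePreserving_eval (fun _ : ι => gaussianReal 0 1) i).integrable_comp_of_integrable
    ((memLp_id_gaussianReal (μ := 0) (v := 1) 1).integrable (by simp))

/-- A continuous function of at most linear growth of a standard Gaussian vector is integrable. -/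
lemma integrable_of_linear_growth {ι : Type*} [Fintype ι] {f : (ι → ℝ) → ℝ} (hf : Continuous f)
    {A B : ℝ} (h : ∀ w, |f w| ≤ A + B * ∑ i, |w i|) : Integrable f (stdGaussianPi ι) := by
  refine Integrable.mono' (g := fun w => A + B * ∑ i, |w i|) ?_ hf.aestronglyMeasurable
    (ae_of_all _ h)
  exact (integrable_const A).add
    ((integrable_finsetSum _ fun i _ => (integrable_eval_stdGaussianPi i).abs).const_mul B)

/-- Gaussian integration by parts in one coordinate. -/
lemma integral_eval_mul_stdGaussianPi {ι : Type*} [Fintype ι] [DecidableEq ι] (i : ι)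
    {f f' : (ι → ℝ) → ℝ} {C C' : ℝ}
    (hf : ∀ w, HasDerivAt (fun t => f (Function.update w i t)) (f' w) (w i))
    (hfc : Continuous f) (hf' : Continuous f')
    (hC : ∀ w, |f w| ≤ C) (hC' : ∀ w, |f' w| ≤ C') :
    Integrable (fun w => w i * f w) (stdGaussianPi ι) ∧ Integrable f' (stdGaussianPi ι) ∧
      ∫ w, w i * f w ∂(stdGaussianPi ι) = ∫ w, f' w ∂(stdGaussianPi ι) := by
  have hu : Continuous (fun p : (ι → ℝ) × ℝ => Function.update p.1 i p.2) :=
    continuous_fst.update i continuous_snd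
  have i1 : Integrable (fun w : ι → ℝ => w i * f w) (stdGaussianPi ι) :=
    (integrable_eval_stdGaussianPi i).mul_bdd (c := C) hfc.aestronglyMeasurable (ae_of_all _ hC)
  have i2 : Integrable f' (stdGaussianPi ι) := integrable_of_bounded hf' hC'
  have key : ∀ g : (ι → ℝ) → ℝ, Integrable g (stdGaussianPi ι) →
      ∫ w, g w ∂(stdGaussianPi ι)
        = ∫ w, ∫ t, g (Function.update w i t) ∂(gaussianReal 0 1) ∂(stdGaussianPi ι) := by
    intro g hg
    have hmp : MeasurePreserving (fun p : (ι → ℝ) × ℝ => Function.update p.1 i p.2)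
      ((stdGaussianPi ι).prod (gaussianReal 0 1)) (stdGaussianPi ι) :=
      ⟨hu.measurable, map_update_stdGaussianPi i⟩
    conv_lhs => rw [← hmp.map_eq]
    rw [integral_map hu.measurable.aemeasurable (by rw [hmp.map_eq]; exact hg.1)]
    exact integral_prod _ (hmp.integrable_comp_of_integrable hg)
  refine ⟨i1, i2, ?_⟩
  rw [key _ i1, key _ i2]
  congr 1; ext w
  have := integral_id_mul_gaussianReal (f := fun t => f (Function.update w i t))
    (f' := fun t => f' (Function.update w i t)) (C := C) (C' := C')
    (fun t => by simpa using hf (Function.update w i t))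
    (hf'.comp (hu.comp (Continuous.prodMk_right w))) (fun _ => hC _) (fun _ => hC' _)
  simpa using this

section SmoothMaximum

set_option linter.unusedSectionVars false

variable {K α J : Type*} [Fintype K] [Fintype α] [Fintype J]

/-- The smooth maximum of a finite family of real numbers, at inverse temperature `β`. -/
noncomputable def logSumExp (β : ℝ) (z : K → ℝ) : ℝ :=
  Real.log (∑ x, Real.exp (β * z x)) / β

/-- The Gibbs weights, which form the gradient of `logSumExp`. -/
noncomputable def gibbs (β : ℝ) (z : K → ℝ) (x : K) : ℝ :=
  Real.exp (β * z x) / ∑ y, Real.exp (β * z y)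

lemma gibbs_nonneg (β : ℝ) (z : K → ℝ) (x : K) : 0 ≤ gibbs β z x := by
  unfold gibbs; positivity

lemma sum_exp_pos [Nonempty K] (β : ℝ) (z : K → ℝ) : 0 < ∑ y, Real.exp (β * z y) :=
  Finset.sum_pos (fun _ _ => Real.exp_pos _) Finset.univ_nonempty

lemma gibbs_le_one [Nonempty K] (β : ℝ) (z : K → ℝ) (x : K) : gibbs β z x ≤ 1 := by
  rw [gibbs, div_le_one (sum_exp_pos β z)]
  exact Finset.single_le_sum (f := fun y => Real.exp (β * z y))
    (fun y _ => (Real.exp_pos _).le) (Finset.mem_univ x)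

lemma le_logSumExp {β : ℝ} (hβ : 0 < β) (z : K → ℝ) (x : K) : z x ≤ logSumExp β z := by
  have : Nonempty K := ⟨x⟩
  rw [logSumExp, le_div_iff₀ hβ, Real.le_log_iff_exp_le (sum_exp_pos β z), mul_comm]
  exact Finset.single_le_sum (f := fun y => Real.exp (β * z y))
    (fun y _ => (Real.exp_pos _).le) (Finset.mem_univ x)

lemma logSumExp_le [Nonempty K] {β : ℝ} (hβ : 0 < β) (z : K → ℝ) {M : ℝ} (h : ∀ x, z x ≤ M) :
    logSumExp β z ≤ M + Real.log (Fintype.card K) / β := by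
  have hK : (0 : ℝ) < Fintype.card K := by exact_mod_cast Fintype.card_pos
  rw [logSumExp, div_le_iff₀ hβ, add_mul, div_mul_cancel₀ _ hβ.ne',
    Real.log_le_iff_le_exp (sum_exp_pos β z), Real.exp_add, Real.exp_log hK]
  calc ∑ x, Real.exp (β * z x) ≤ ∑ _x : K, Real.exp (M * β) := by
        refine Finset.sum_le_sum fun x _ => Real.exp_le_exp.2 ?_
        rw [mul_comm]
        exact mul_le_mul_of_nonneg_right (h x) hβ.le
    _ = _ := by simp [mul_comm]

lemma hasDerivAt_logSumExp [Nonempty K] {β : ℝ} (hβ : 0 < β) {z : ℝ → K → ℝ} {z' : K → ℝ} {t : ℝ}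
    (h : ∀ x, HasDerivAt (fun t => z t x) (z' x) t) :
    HasDerivAt (fun t => logSumExp β (z t)) (∑ x, gibbs β (z t) x * z' x) t := by
  have h1 : HasDerivAt (fun t => ∑ x, Real.exp (β * z t x))
      (∑ x, Real.exp (β * z t x) * (β * z' x)) t :=
    HasDerivAt.fun_sum fun x _ => ((h x).const_mul β).exp
  refine ((h1.log (sum_exp_pos β (z t)).ne').div_const β).congr_deriv ?_
  simp only [gibbs, Finset.sum_div]
  refine Finset.sum_congr rfl fun x _ => ?_
  field_simp

lemma hasDerivAt_gibbs [Nonempty K] (β : ℝ) {z : ℝ → K → ℝ} {z' : K → ℝ} {t : ℝ}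
    (h : ∀ x, HasDerivAt (fun t => z t x) (z' x) t) (x : K) :
    HasDerivAt (fun t => gibbs β (z t) x)
      (β * gibbs β (z t) x * (z' x - ∑ y, gibbs β (z t) y * z' y)) t := by
  have h1 : HasDerivAt (fun t => ∑ x, Real.exp (β * z t x))
      (∑ x, Real.exp (β * z t x) * (β * z' x)) t :=
    HasDerivAt.fun_sum fun x _ => ((h x).const_mul β).exp
  have hpos := sum_exp_pos β (z t)
  refine ((((h x).const_mul β).exp).fun_div h1 hpos.ne').congr_deriv ?_
  have e1 : ∑ y, gibbs β (z t) y * z' y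
      = (∑ x, Real.exp (β * z t x) * z' x) / ∑ y, Real.exp (β * z t y) := by
    rw [Finset.sum_div]
    exact Finset.sum_congr rfl fun y _ => by rw [gibbs]; ring
  have e2 : ∑ x, Real.exp (β * z t x) * (β * z' x) = β * ∑ x, Real.exp (β * z t x) * z' x := by
    rw [Finset.mul_sum]
    exact Finset.sum_congr rfl fun y _ => by ring
  rw [e1, e2, gibbs]
  field_simp

lemma continuous_gibbs [Nonempty K] {Y : Type*} [TopologicalSpace Y] (β : ℝ) {z : Y → K → ℝ}
    (hz : ∀ x, Continuous fun y => z y x) (x : K) : Continuous fun y => gibbs β (z y) x := by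
  unfold gibbs
  exact Continuous.div (by fun_prop) (by fun_prop) fun y => (sum_exp_pos β (z y)).ne'

lemma continuous_logSumExp [Nonempty K] {Y : Type*} [TopologicalSpace Y] (β : ℝ) {z : Y → K → ℝ}
    (hz : ∀ x, Continuous fun y => z y x) : Continuous fun y => logSumExp β (z y) := by
  unfold logSumExp
  exact (Continuous.log (by fun_prop) fun y => (sum_exp_pos β (z y)).ne').div_const β

/-- A smooth approximation of the Euclidean norm. -/
noncomputable def smoothNorm (v : α → ℝ) : ℝ := √(1 + ∑ a, v a ^ 2)

lemma one_le_smoothNorm (v : α → ℝ) : 1 ≤ smoothNorm v := by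
  rw [smoothNorm, Real.one_le_sqrt]
  have : 0 ≤ ∑ a, v a ^ 2 := by positivity
  linarith

lemma smoothNorm_pos (v : α → ℝ) : 0 < smoothNorm v := one_pos.trans_le (one_le_smoothNorm v)

lemma abs_le_smoothNorm (v : α → ℝ) (a : α) : |v a| ≤ smoothNorm v := by
  refine Real.abs_le_sqrt ?_
  have := Finset.single_le_sum (f := fun a => v a ^ 2) (fun _ _ => sq_nonneg _) (Finset.mem_univ a)
  linarith

lemma sqrt_le_smoothNorm (v : α → ℝ) : √(∑ a, v a ^ 2) ≤ smoothNorm v :=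
  Real.sqrt_le_sqrt (by linarith)

lemma smoothNorm_le (v : α → ℝ) : smoothNorm v ≤ √(∑ a, v a ^ 2) + 1 := by
  refine Real.sqrt_le_iff.2 ⟨by positivity, ?_⟩
  have : 0 ≤ ∑ a, v a ^ 2 := by positivity
  nlinarith [Real.sq_sqrt this, Real.sqrt_nonneg (∑ a, v a ^ 2)]

lemma sum_div_smoothNorm_mul_le_one (v w : α → ℝ) :
    ∑ a, v a / smoothNorm v * (w a / smoothNorm w) ≤ 1 := by
  have hv := smoothNorm_pos v
  have hw := smoothNorm_pos w
  have e : ∑ a, v a / smoothNorm v * (w a / smoothNorm w)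
      = (∑ a, v a * w a) / (smoothNorm v * smoothNorm w) := by
    rw [Finset.sum_div]
    exact Finset.sum_congr rfl fun a _ => by field_simp
  rw [e, div_le_one (by positivity)]
  refine (Real.sum_mul_le_sqrt_mul_sqrt _ v w).trans ?_
  exact mul_le_mul (sqrt_le_smoothNorm v) (sqrt_le_smoothNorm w) (Real.sqrt_nonneg _) hv.le

lemma abs_div_smoothNorm_le_one (v : α → ℝ) (a : α) : |v a / smoothNorm v| ≤ 1 := by
  rw [abs_div, abs_of_pos (smoothNorm_pos v), div_le_one (smoothNorm_pos v)]
  exact abs_le_smoothNorm v a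

lemma hasDerivAt_smoothNorm {v : ℝ → α → ℝ} {v' : α → ℝ} {t : ℝ}
    (h : ∀ a, HasDerivAt (fun t => v t a) (v' a) t) :
    HasDerivAt (fun t => smoothNorm (v t)) (∑ a, v t a / smoothNorm (v t) * v' a) t := by
  have h1 : HasDerivAt (fun t => 1 + ∑ a, v t a ^ 2) (∑ a, 2 * v t a * v' a) t := by
    refine (HasDerivAt.const_add 1 (HasDerivAt.fun_sum fun a _ => (h a).fun_pow 2)).congr_deriv ?_
    simp
  have hne : 1 + ∑ a, v t a ^ 2 ≠ 0 := by positivity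
  refine (h1.sqrt hne).congr_deriv ?_
  rw [Finset.sum_div]
  refine Finset.sum_congr rfl fun a _ => ?_
  have := smoothNorm_pos (v t)
  change _ / (2 * smoothNorm (v t)) = _
  field_simp

lemma continuous_smoothNorm {Y : Type*} [TopologicalSpace Y] {v : Y → α → ℝ}
    (hv : ∀ a, Continuous fun y => v y a) : Continuous fun y => smoothNorm (v y) := by
  unfold smoothNorm
  fun_prop

/-- The inner product of a row of a matrix with a vector. -/
def rowDot {R : Type*} (W : R × J → ℝ) (r : R) (p : J → ℝ) : ℝ := ∑ j, W (r, j) * p j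

lemma hasDerivAt_rowDot_update {R : Type*} [DecidableEq R] [DecidableEq J] (W : R × J → ℝ)
    (r r' : R) (j : J) (p : J → ℝ) :
    HasDerivAt (fun t => rowDot (Function.update W (r, j) t) r' p)
      (if r' = r then p j else 0) (W (r, j)) := by
  have h : ∀ j', HasDerivAt (fun t => Function.update W (r, j) t (r', j') * p j')
      (if (r', j') = (r, j) then p j' else 0) (W (r, j)) := by
    intro j'
    by_cases hj : (r', j') = (r, j)
    · rw [hj]
      simpa using (hasDerivAt_id (W (r, j))).mul_const (p j')
    · simpa [Function.update_of_ne hj, hj] using hasDerivAt_const (W (r, j)) (W (r', j') * p j')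
  refine (HasDerivAt.fun_sum fun j' _ => h j').congr_deriv ?_
  by_cases hr : r' = r <;> simp [hr]

lemma continuous_rowDot {R : Type*} (r : R) (p : J → ℝ) :
    Continuous fun W : R × J → ℝ => rowDot W r p := by
  unfold rowDot; fun_prop

/-- The rows of index `some a` of a matrix applied to a vector. -/
def rowsDot (W : Option α × J → ℝ) (p : J → ℝ) (a : α) : ℝ := rowDot W (some a) p

/-- The Gaussian field `± (‖G p‖ + ⟨h, q⟩) + c`, with the norm smoothed. Here `h` is the row of
index `none` of the Gaussian matrix, and `G` consists of the other rows. -/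
noncomputable def normField (s : ℝ) (p q : K → J → ℝ) (c : K → ℝ) (W : Option α × J → ℝ)
    (x : K) : ℝ :=
  s * (smoothNorm (rowsDot W (p x)) + rowDot W none (q x)) + c x

lemma continuous_rowsDot (p : J → ℝ) (a : α) :
    Continuous fun W : Option α × J → ℝ => rowsDot W p a :=
  continuous_rowDot (some a) p

lemma continuous_smoothNorm_rowsDot (p : J → ℝ) :
    Continuous fun W : Option α × J → ℝ => smoothNorm (rowsDot W p) :=
  continuous_smoothNorm fun a => continuous_rowsDot p a

lemma continuous_normField (s : ℝ) (p q : K → J → ℝ) (c : K → ℝ) (x : K) :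
    Continuous fun W : Option α × J → ℝ => normField s p q c W x := by
  unfold normField
  exact (((continuous_smoothNorm_rowsDot (p x)).add (continuous_rowDot none (q x))).const_mul
    s).add_const (c x)

lemma hasDerivAt_normField_update_some [DecidableEq α] [DecidableEq J] (s : ℝ) (p q : K → J → ℝ)
    (c : K → ℝ) (W : Option α × J → ℝ) (a : α) (j : J) (x : K) :
    HasDerivAt (fun t => normField s p q c (Function.update W (some a, j) t) x)
      (s * (rowsDot W (p x) a / smoothNorm (rowsDot W (p x)) * p x j)) (W (some a, j)) := by
  have h1 : ∀ b, HasDerivAt (fun t => rowsDot (Function.update W (some a, j) t) (p x) b)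
      (if b = a then p x j else 0) (W (some a, j)) := by
    intro b
    simpa [rowsDot] using hasDerivAt_rowDot_update W (some a) (some b) j (p x)
  have h2 := hasDerivAt_rowDot_update W (some a) none j (q x)
  have h3 := (((hasDerivAt_smoothNorm h1).add h2).const_mul s).add_const (c x)
  refine h3.congr_deriv ?_
  simp

lemma hasDerivAt_normField_update_none [DecidableEq α] [DecidableEq J] (s : ℝ) (p q : K → J → ℝ)
    (c : K → ℝ) (W : Option α × J → ℝ) (j : J) (x : K) :
    HasDerivAt (fun t => normField s p q c (Function.update W (none, j) t) x)
      (s * q x j) (W (none, j)) := by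
  have h1 : ∀ b, HasDerivAt (fun t => rowsDot (Function.update W (none, j) t) (p x) b)
      0 (W (none, j)) := by
    intro b
    simpa [rowsDot] using hasDerivAt_rowDot_update W none (some b) j (p x)
  have h2 := hasDerivAt_rowDot_update W none none j (q x)
  have h3 := (((hasDerivAt_smoothNorm h1).add h2).const_mul s).add_const (c x)
  refine h3.congr_deriv ?_
  simp

lemma abs_gibbs_le_one [Nonempty K] (β : ℝ) (z : K → ℝ) (x : K) : |gibbs β z x| ≤ 1 := by
  rw [abs_of_nonneg (gibbs_nonneg β z x)]
  exact gibbs_le_one β z x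

lemma integral_eval_none_mul_gibbs [Nonempty K] (β s : ℝ) (p q : K → J → ℝ) (c : K → ℝ) (x : K)
    (j : J) :
    Integrable (fun W => W (none, j) * gibbs β (normField s p q c W) x)
        (stdGaussianPi (Option α × J)) ∧
    Integrable (fun W => β * gibbs β (normField s p q c W) x *
          (s * q x j - ∑ y, gibbs β (normField s p q c W) y * (s * q y j)))
        (stdGaussianPi (Option α × J)) ∧
    ∫ W : Option α × J → ℝ, W (none, j) * gibbs β (normField s p q c W) x
        ∂(stdGaussianPi (Option α × J))
      = ∫ W : Option α × J → ℝ, β * gibbs β (normField s p q c W) x *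
          (s * q x j - ∑ y, gibbs β (normField s p q c W) y * (s * q y j))
        ∂(stdGaussianPi (Option α × J)) := by
  classical
  have hg : ∀ x, Continuous fun W : Option α × J → ℝ => gibbs β (normField s p q c W) x :=
    fun x => continuous_gibbs β (fun y => continuous_normField s p q c y) x
  refine integral_eval_mul_stdGaussianPi (none, j) (C := 1)
    (C' := |β| * 1 * (|s * q x j| + ∑ y, 1 * |s * q y j|)) (fun W => ?_) (hg x)
    (by fun_prop) (fun W => abs_gibbs_le_one β _ x) (fun W => ?_)
  · simpa using hasDerivAt_gibbs β
      (z := fun t => normField s p q c (Function.update W (none, j) t)) (t := W (none, j))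
      (fun y => hasDerivAt_normField_update_none s p q c W j y) x
  · rw [abs_mul, abs_mul]
    gcongr
    · exact abs_gibbs_le_one β _ x
    · refine (abs_sub _ _).trans ?_
      gcongr
      refine (Finset.abs_sum_le_sum_abs _ _).trans ?_
      gcongr with y
      rw [abs_mul]
      gcongr
      exact abs_gibbs_le_one β _ y

lemma integral_eval_some_mul_gibbs [Nonempty K] {β s : ℝ} (hs : |s| = 1) (p q : K → J → ℝ)
    (c : K → ℝ) (x : K) (a : α) (j : J) :
    Integrable (fun W => W (some a, j) * (gibbs β (normField s p q c W) x *
          (rowsDot W (p x) a / smoothNorm (rowsDot W (p x)))))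
        (stdGaussianPi (Option α × J)) ∧
    Integrable (fun W => β * gibbs β (normField s p q c W) x *
            (s * (rowsDot W (p x) a / smoothNorm (rowsDot W (p x)) * p x j)
              - ∑ y, gibbs β (normField s p q c W) y *
                (s * (rowsDot W (p y) a / smoothNorm (rowsDot W (p y)) * p y j))) *
            (rowsDot W (p x) a / smoothNorm (rowsDot W (p x)))
          + gibbs β (normField s p q c W) x * (((1 - (rowsDot W (p x) a /
              smoothNorm (rowsDot W (p x))) ^ 2) / smoothNorm (rowsDot W (p x))) * p x j))
        (stdGaussianPi (Option α × J)) ∧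
    ∫ W : Option α × J → ℝ, W (some a, j) * (gibbs β (normField s p q c W) x *
          (rowsDot W (p x) a / smoothNorm (rowsDot W (p x))))
        ∂(stdGaussianPi (Option α × J))
      = ∫ W : Option α × J → ℝ, β * gibbs β (normField s p q c W) x *
            (s * (rowsDot W (p x) a / smoothNorm (rowsDot W (p x)) * p x j)
              - ∑ y, gibbs β (normField s p q c W) y *
                (s * (rowsDot W (p y) a / smoothNorm (rowsDot W (p y)) * p y j))) *
            (rowsDot W (p x) a / smoothNorm (rowsDot W (p x)))
          + gibbs β (normField s p q c W) x * (((1 - (rowsDot W (p x) a /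
              smoothNorm (rowsDot W (p x))) ^ 2) / smoothNorm (rowsDot W (p x))) * p x j)
        ∂(stdGaussianPi (Option α × J)) := by
  classical
  have hg : ∀ x, Continuous fun W : Option α × J → ℝ => gibbs β (normField s p q c W) x :=
    fun x => continuous_gibbs β (fun y => continuous_normField s p q c y) x
  have hφ : ∀ x, Continuous fun W : Option α × J → ℝ => smoothNorm (rowsDot W (p x)) :=
    fun x => continuous_smoothNorm_rowsDot (p x)
  have hne : ∀ x (W : Option α × J → ℝ), smoothNorm (rowsDot W (p x)) ≠ 0 :=
    fun x W => (smoothNorm_pos _).ne'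
  have hu : ∀ x, Continuous fun W : Option α × J → ℝ =>
      rowsDot W (p x) a / smoothNorm (rowsDot W (p x)) :=
    fun x => (continuous_rowsDot (p x) a).div (hφ x) (hne x)
  have hu1 : ∀ y (W : Option α × J → ℝ),
      |rowsDot W (p y) a / smoothNorm (rowsDot W (p y))| ≤ 1 :=
    fun y W => abs_div_smoothNorm_le_one _ a
  refine integral_eval_mul_stdGaussianPi (some a, j) (C := 1 * 1)
    (C' := |β| * 1 * (1 * (1 * |p x j|) + ∑ y, 1 * (1 * (1 * |p y j|))) * 1 + 1 * (1 / 1 * |p x j|))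
    (fun W => ?_) ((hg x).mul (hu x)) ?_ (fun W => ?_) (fun W => ?_)
  · have h1 := hasDerivAt_gibbs β
      (z := fun t => normField s p q c (Function.update W (some a, j) t)) (t := W (some a, j))
      (fun y => hasDerivAt_normField_update_some s p q c W a j y) x
    have h2 : ∀ b, HasDerivAt (fun t => rowsDot (Function.update W (some a, j) t) (p x) b)
        (if b = a then p x j else 0) (W (some a, j)) := by
      intro b
      simpa [rowsDot] using hasDerivAt_rowDot_update W (some a) (some b) j (p x)
    have h3 := (h2 a).fun_div (hasDerivAt_smoothNorm h2) (hne x _)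
    refine (h1.fun_mul h3).congr_deriv ?_
    simp only [Function.update_eq_self, if_true, mul_ite, mul_zero, Finset.sum_ite_eq',
      Finset.mem_univ]
    have := hne x W
    field_simp
  · have h1 : Continuous fun W : Option α × J → ℝ =>
        (1 - (rowsDot W (p x) a / smoothNorm (rowsDot W (p x))) ^ 2) /
          smoothNorm (rowsDot W (p x)) :=
      (continuous_const.sub ((hu x).pow 2)).div (hφ x) (hne x)
    fun_prop
  · rw [abs_mul]
    gcongr
    · exact abs_gibbs_le_one β _ x
    · exact hu1 x W
  · refine (abs_add_le _ _).trans (add_le_add ?_ ?_)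
    · rw [abs_mul, abs_mul, abs_mul]
      gcongr
      · exact abs_gibbs_le_one β _ x
      · refine (abs_sub _ _).trans ?_
        rw [abs_mul, abs_mul, hs]
        gcongr
        · exact hu1 x W
        · refine (Finset.abs_sum_le_sum_abs _ _).trans ?_
          gcongr with y
          rw [abs_mul, abs_mul, abs_mul, hs]
          gcongr
          · exact abs_gibbs_le_one β _ y
          · exact hu1 y W
      · exact hu1 x W
    · rw [abs_mul, abs_mul, abs_div]
      gcongr
      · exact abs_gibbs_le_one β _ x
      · have h := (sq_le_one_iff_abs_le_one _).2 (hu1 x W)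
        rw [abs_of_nonneg (by linarith)]
        linarith [sq_nonneg (rowsDot W (p x) a / smoothNorm (rowsDot W (p x)))]
      · exact (one_le_smoothNorm _).trans (le_abs_self _)

lemma sum_covariance_identity {β s : ℝ} (hs : s ^ 2 = 1) (P : K → ℝ) (u : K → α → ℝ) (d : α → ℝ)
    (p q : K → J → ℝ) (p' q' : J → ℝ) (κ : K → ℝ) (x : K)
    (hp : ∀ y, ∑ j, p y j * p' j = κ y) (hq : ∀ y, ∑ j, q y j * q' j = -κ y) (hx : κ x = 0) :
    ∑ a, ∑ j, s * p' j * (β * P x * (s * (u x a * p x j) - ∑ y, P y * (s * (u y a * p y j))) * u x a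
        + P x * (d a * p x j))
      + ∑ j, s * q' j * (β * P x * (s * q x j - ∑ y, P y * (s * q y j)))
      = β * P x * ∑ y, P y * κ y * (1 - ∑ a, u x a * u y a) := by
  have hsw : ∀ (r : K → ℝ) (f : K → J → ℝ) (f' : J → ℝ),
      ∑ j, f' j * ∑ y, r y * f y j = ∑ y, r y * ∑ j, f y j * f' j := by
    intro r f f'
    simp only [Finset.mul_sum]
    rw [Finset.sum_comm]
    exact Finset.sum_congr rfl fun y _ => Finset.sum_congr rfl fun j _ => by ring
  have h1 : ∀ a, ∑ j, s * p' j * (β * P x * (s * (u x a * p x j)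
        - ∑ y, P y * (s * (u y a * p y j))) * u x a + P x * (d a * p x j))
      = - (β * P x * u x a * ∑ y, P y * u y a * κ y) := by
    intro a
    have e : ∀ j, s * p' j * (β * P x * (s * (u x a * p x j)
        - ∑ y, P y * (s * (u y a * p y j))) * u x a + P x * (d a * p x j))
        = (s ^ 2 * β * P x * u x a ^ 2 + s * P x * d a) * (p x j * p' j)
          - s ^ 2 * β * P x * u x a * (p' j * ∑ y, P y * u y a * p y j) := by
      intro j
      have : ∑ y, P y * (s * (u y a * p y j)) = s * ∑ y, P y * u y a * p y j := by
        rw [Finset.mul_sum]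
        exact Finset.sum_congr rfl fun y _ => by ring
      rw [this]
      ring
    simp only [e]
    rw [Finset.sum_sub_distrib, ← Finset.mul_sum, ← Finset.mul_sum, hsw, hp, hx, hs]
    simp only [hp]
    ring
  have h2 : ∑ j, s * q' j * (β * P x * (s * q x j - ∑ y, P y * (s * q y j)))
      = β * P x * ∑ y, P y * κ y := by
    have e : ∀ j, s * q' j * (β * P x * (s * q x j - ∑ y, P y * (s * q y j)))
        = s ^ 2 * β * P x * (q x j * q' j) - s ^ 2 * β * P x * (q' j * ∑ y, P y * q y j) := by
      intro j
      have : ∑ y, P y * (s * q y j) = s * ∑ y, P y * q y j := by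
        rw [Finset.mul_sum]
        exact Finset.sum_congr rfl fun y _ => by ring
      rw [this]
      ring
    simp only [e]
    rw [Finset.sum_sub_distrib, ← Finset.mul_sum, ← Finset.mul_sum, hsw, hq, hx, hs]
    simp only [hq, mul_neg, Finset.sum_neg_distrib]
    ring
  simp only [h1]
  rw [h2, Finset.sum_neg_distrib]
  have h3 : ∑ a, β * P x * u x a * ∑ y, P y * u y a * κ y
      = β * P x * ∑ y, P y * κ y * ∑ a, u x a * u y a := by
    simp only [Finset.mul_sum]
    rw [Finset.sum_comm]
    exact Finset.sum_congr rfl fun y _ => Finset.sum_congr rfl fun a _ => by ring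
  rw [h3]
  simp only [mul_sub, mul_one, Finset.sum_sub_distrib]
  ring

/-- Along an interpolation which moves covariance from the vector part of the field to its scalar
part, the expectation of the smooth maximum has nonnegative derivative. -/
lemma integral_gibbs_mul_deriv_nonneg [Nonempty K] {β s : ℝ} (hβ : 0 ≤ β) (hs : s ^ 2 = 1)
    (p q p' q' : K → J → ℝ) (c : K → ℝ) (κ : K → K → ℝ)
    (hp : ∀ x y, ∑ j, p y j * p' x j = κ x y) (hq : ∀ x y, ∑ j, q y j * q' x j = -κ x y)
    (hκ : ∀ x y, 0 ≤ κ x y) (hx : ∀ x, κ x x = 0) :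
    0 ≤ ∫ W : Option α × J → ℝ, ∑ x, gibbs β (normField s p q c W) x *
      (s * (∑ a, rowsDot W (p x) a / smoothNorm (rowsDot W (p x)) * rowsDot W (p' x) a
        + rowDot W none (q' x))) ∂(stdGaussianPi (Option α × J)) := by
  have hs1 : |s| = 1 := by
    rcases sq_eq_one_iff.1 hs with h | h <;> simp [h]
  have hsome := fun (x : K) (a : α) (j : J) => integral_eval_some_mul_gibbs (β := β) hs1 p q c x a j
  have hnone := fun (x : K) (j : J) => integral_eval_none_mul_gibbs (α := α) β s p q c x j
  have e : ∀ W : Option α × J → ℝ, ∑ x, gibbs β (normField s p q c W) x *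
      (s * (∑ a, rowsDot W (p x) a / smoothNorm (rowsDot W (p x)) * rowsDot W (p' x) a
        + rowDot W none (q' x)))
      = ∑ x, (∑ a, ∑ j, s * p' x j * (W (some a, j) * (gibbs β (normField s p q c W) x *
          (rowsDot W (p x) a / smoothNorm (rowsDot W (p x)))))
        + ∑ j, s * q' x j * (W (none, j) * gibbs β (normField s p q c W) x)) := by
    intro W
    refine Finset.sum_congr rfl fun x _ => ?_
    rw [mul_add, mul_add]
    congr 1
    · rw [Finset.mul_sum, Finset.mul_sum]
      refine Finset.sum_congr rfl fun a _ => ?_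
      rw [show rowsDot W (p' x) a = ∑ j, W (some a, j) * p' x j from rfl]
      simp only [Finset.mul_sum]
      exact Finset.sum_congr rfl fun j _ => by ring
    · rw [rowDot]
      simp only [Finset.mul_sum]
      exact Finset.sum_congr rfl fun j _ => by ring
  simp only [e]
  have swap : ∀ (F : K → α → J → (Option α × J → ℝ) → ℝ) (F0 : K → J → (Option α × J → ℝ) → ℝ),
      (∀ x a j, Integrable (F x a j) (stdGaussianPi (Option α × J))) →
      (∀ x j, Integrable (F0 x j) (stdGaussianPi (Option α × J))) →
      ∫ W, ∑ x, (∑ a, ∑ j, s * p' x j * F x a j W + ∑ j, s * q' x j * F0 x j W)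
          ∂(stdGaussianPi (Option α × J))
        = ∑ x, (∑ a, ∑ j, s * p' x j * ∫ W, F x a j W ∂(stdGaussianPi (Option α × J))
          + ∑ j, s * q' x j * ∫ W, F0 x j W ∂(stdGaussianPi (Option α × J))) := by
    intro F F0 hF hF0
    have i1 : ∀ x a, Integrable (fun W => ∑ j, s * p' x j * F x a j W)
        (stdGaussianPi (Option α × J)) :=
      fun x a => integrable_finsetSum _ fun j _ => (hF x a j).const_mul _
    have i2 : ∀ x, Integrable (fun W => ∑ a, ∑ j, s * p' x j * F x a j W)
        (stdGaussianPi (Option α × J)) :=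
      fun x => integrable_finsetSum _ fun a _ => i1 x a
    have i3 : ∀ x, Integrable (fun W => ∑ j, s * q' x j * F0 x j W)
        (stdGaussianPi (Option α × J)) :=
      fun x => integrable_finsetSum _ fun j _ => (hF0 x j).const_mul _
    have i4 : ∀ x, Integrable (fun W => ∑ a, ∑ j, s * p' x j * F x a j W
        + ∑ j, s * q' x j * F0 x j W) (stdGaussianPi (Option α × J)) :=
      fun x => (i2 x).add (i3 x)
    rw [integral_finsetSum _ fun x _ => i4 x]
    refine Finset.sum_congr rfl fun x _ => ?_
    rw [integral_add (i2 x) (i3 x), integral_finsetSum _ fun a _ => i1 x a,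
      integral_finsetSum _ fun j _ => (hF0 x j).const_mul _]
    congr 1
    · refine Finset.sum_congr rfl fun a _ => ?_
      rw [integral_finsetSum _ fun j _ => (hF x a j).const_mul _]
      exact Finset.sum_congr rfl fun j _ => integral_const_mul _ _
    · exact Finset.sum_congr rfl fun j _ => integral_const_mul _ _
  rw [swap _ _ (fun x a j => (hsome x a j).1) (fun x j => (hnone x j).1)]
  simp only [fun x a j => (hsome x a j).2.2, fun x j => (hnone x j).2.2]
  rw [← swap _ _ (fun x a j => (hsome x a j).2.1) (fun x j => (hnone x j).2.1)]
  refine integral_nonneg fun W => Finset.sum_nonneg fun x _ => ?_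
  rw [sum_covariance_identity hs (gibbs β (normField s p q c W))
    (fun y a => rowsDot W (p y) a / smoothNorm (rowsDot W (p y))) _ p q (p' x) (q' x) (κ x) x
    (hp x) (hq x) (hx x)]
  refine mul_nonneg (mul_nonneg hβ (gibbs_nonneg _ _ _)) (Finset.sum_nonneg fun y _ => ?_)
  refine mul_nonneg (mul_nonneg (gibbs_nonneg _ _ _) (hκ x y)) ?_
  have := sum_div_smoothNorm_mul_le_one (rowsDot W (p x)) (rowsDot W (p y))
  linarith

lemma abs_rowDot_le {R : Type*} [Fintype R] (W : R × J → ℝ) (r : R) {p : J → ℝ} {M : ℝ}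
    (hp : ∀ j, |p j| ≤ M) (hM : 0 ≤ M) : |rowDot W r p| ≤ M * ∑ i, |W i| := by
  calc |rowDot W r p| ≤ ∑ j, |W (r, j) * p j| := Finset.abs_sum_le_sum_abs _ _
    _ ≤ ∑ j, M * |W (r, j)| := by
        refine Finset.sum_le_sum fun j _ => ?_
        rw [abs_mul, mul_comm]
        exact mul_le_mul_of_nonneg_right (hp j) (abs_nonneg _)
    _ = M * ∑ j, |W (r, j)| := by rw [Finset.mul_sum]
    _ ≤ M * ∑ i, |W i| := by
        gcongr
        rw [Fintype.sum_prod_type]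
        exact Finset.single_le_sum (f := fun r => ∑ j, |W (r, j)|)
          (fun _ _ => Finset.sum_nonneg fun _ _ => abs_nonneg _) (Finset.mem_univ r)

lemma abs_logSumExp_le [Nonempty K] {β : ℝ} (hβ : 0 < β) (z : K → ℝ) :
    |logSumExp β z| ≤ ∑ x, |z x| + Real.log (Fintype.card K) / β := by
  have hz : ∀ x, |z x| ≤ ∑ x, |z x| := fun x =>
    Finset.single_le_sum (f := fun x => |z x|) (fun _ _ => abs_nonneg _) (Finset.mem_univ x)
  have hlog : 0 ≤ Real.log (Fintype.card K) / β :=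
    div_nonneg (Real.log_natCast_nonneg _) hβ.le
  refine abs_le.2 ⟨?_, logSumExp_le hβ z fun x => (le_abs_self _).trans (hz x)⟩
  obtain ⟨x⟩ := ‹Nonempty K›
  have := le_logSumExp hβ z x
  linarith [hz x, neg_abs_le (z x)]

lemma sqrt_sum_sq_le_sum_abs (v : α → ℝ) : √(∑ a, v a ^ 2) ≤ ∑ a, |v a| := by
  refine Real.sqrt_le_iff.2 ⟨by positivity, ?_⟩
  calc ∑ a, v a ^ 2 = ∑ a, |v a| ^ 2 := by simp
    _ ≤ (∑ a, |v a|) ^ 2 := Finset.sum_sq_le_sq_sum_of_nonneg fun _ _ => abs_nonneg _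

lemma integrable_logSumExp_normField [Nonempty K] {β : ℝ} (hβ : 0 < β) (s : ℝ)
    (p q : K → J → ℝ) (c : K → ℝ) :
    Integrable (fun W => logSumExp β (normField s p q c W)) (stdGaussianPi (Option α × J)) := by
  have hp : ∀ x j, |p x j| ≤ ∑ x, ∑ j, (|p x j| + |q x j|) := fun x j =>
    calc |p x j| ≤ |p x j| + |q x j| := by linarith [abs_nonneg (q x j)]
      _ ≤ ∑ j, (|p x j| + |q x j|) := Finset.single_le_sum (f := fun j => |p x j| + |q x j|)
          (fun _ _ => by positivity) (Finset.mem_univ j)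
      _ ≤ _ := Finset.single_le_sum (f := fun x => ∑ j, (|p x j| + |q x j|))
          (fun _ _ => by positivity) (Finset.mem_univ x)
  have hq : ∀ x j, |q x j| ≤ ∑ x, ∑ j, (|p x j| + |q x j|) := fun x j =>
    calc |q x j| ≤ |p x j| + |q x j| := by linarith [abs_nonneg (p x j)]
      _ ≤ ∑ j, (|p x j| + |q x j|) := Finset.single_le_sum (f := fun j => |p x j| + |q x j|)
          (fun _ _ => by positivity) (Finset.mem_univ j)
      _ ≤ _ := Finset.single_le_sum (f := fun x => ∑ j, (|p x j| + |q x j|))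
          (fun _ _ => by positivity) (Finset.mem_univ x)
  have hM : 0 ≤ ∑ x, ∑ j, (|p x j| + |q x j|) := by positivity
  set M := ∑ x, ∑ j, (|p x j| + |q x j|)
  refine integrable_of_linear_growth
    (A := ∑ x : K, (|s| + |c x|) + Real.log (Fintype.card K) / β)
    (B := ∑ _x : K, |s| * (∑ _a : α, M + M))
    (continuous_logSumExp β fun x => continuous_normField s p q c x) fun W => ?_
  refine (abs_logSumExp_le hβ _).trans ?_
  have hz : ∀ x, |normField s p q c W x|
      ≤ (|s| + |c x|) + |s| * (∑ _a : α, M + M) * ∑ i, |W i| := by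
    intro x
    have h1 : |smoothNorm (rowsDot W (p x))| ≤ 1 + ∑ _a : α, M * ∑ i, |W i| := by
      rw [abs_of_pos (smoothNorm_pos _)]
      have := smoothNorm_le (rowsDot W (p x))
      have h2 := sqrt_sum_sq_le_sum_abs (rowsDot W (p x))
      have h3 : ∑ a, |rowsDot W (p x) a| ≤ ∑ _a : α, M * ∑ i, |W i| :=
        Finset.sum_le_sum fun a _ => abs_rowDot_le W (some a) (hp x) hM
      linarith
    have h2 : |rowDot W none (q x)| ≤ M * ∑ i, |W i| := abs_rowDot_le W none (hq x) hM
    calc |normField s p q c W x|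
        ≤ |s| * (|smoothNorm (rowsDot W (p x))| + |rowDot W none (q x)|) + |c x| := by
          refine (abs_add_le _ _).trans ?_
          rw [abs_mul]
          gcongr
          exact abs_add_le _ _
      _ ≤ |s| * (1 + ∑ _a : α, M * ∑ i, |W i| + M * ∑ i, |W i|) + |c x| := by gcongr
      _ = _ := by rw [← Finset.sum_mul]; ring
  have h4 := Finset.sum_le_sum fun x (_ : x ∈ Finset.univ) => hz x
  rw [Finset.sum_add_distrib, ← Finset.sum_mul] at h4
  linarith

lemma hasDerivAt_normField {p q : ℝ → K → J → ℝ} {p' q' : K → J → ℝ} (s : ℝ) (c : K → ℝ) {θ : ℝ}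
    (hp : ∀ x j, HasDerivAt (fun θ => p θ x j) (p' x j) θ)
    (hq : ∀ x j, HasDerivAt (fun θ => q θ x j) (q' x j) θ) (W : Option α × J → ℝ) (x : K) :
    HasDerivAt (fun θ => normField s (p θ) (q θ) c W x)
      (s * (∑ a, rowsDot W (p θ x) a / smoothNorm (rowsDot W (p θ x)) * rowsDot W (p' x) a
        + rowDot W none (q' x))) θ := by
  have h1 : ∀ a, HasDerivAt (fun θ => rowsDot W (p θ x) a) (rowsDot W (p' x) a) θ := fun a =>
    HasDerivAt.fun_sum fun j _ => (hp x j).const_mul _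
  have h2 : HasDerivAt (fun θ => rowDot W none (q θ x)) (rowDot W none (q' x)) θ :=
    HasDerivAt.fun_sum fun j _ => (hq x j).const_mul _
  exact (((hasDerivAt_smoothNorm h1).add h2).const_mul s).add_const (c x)

lemma hasDerivAt_integral_logSumExp [Nonempty K] {β : ℝ} (hβ : 0 < β) (s : ℝ)
    {p q p' q' : ℝ → K → J → ℝ} (c : K → ℝ) {M : ℝ} (hM : 0 ≤ M)
    (hp : ∀ θ x j, HasDerivAt (fun θ => p θ x j) (p' θ x j) θ)
    (hq : ∀ θ x j, HasDerivAt (fun θ => q θ x j) (q' θ x j) θ)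
    (hpM : ∀ θ x j, |p' θ x j| ≤ M) (hqM : ∀ θ x j, |q' θ x j| ≤ M) (θ : ℝ) :
    HasDerivAt
      (fun θ => ∫ W : Option α × J → ℝ, logSumExp β (normField s (p θ) (q θ) c W)
        ∂(stdGaussianPi (Option α × J)))
      (∫ W : Option α × J → ℝ, ∑ x, gibbs β (normField s (p θ) (q θ) c W) x *
        (s * (∑ a, rowsDot W (p θ x) a / smoothNorm (rowsDot W (p θ x)) * rowsDot W (p' θ x) a
          + rowDot W none (q' θ x))) ∂(stdGaussianPi (Option α × J))) θ := by
  refine (hasDerivAt_integral_of_dominated_loc_of_deriv_le (s := Set.univ)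
    (bound := fun W => ∑ _x : K, 1 * (|s| * (∑ _a : α, 1 * (M * ∑ i, |W i|) + M * ∑ i, |W i|)))
    Filter.univ_mem (Filter.Eventually.of_forall fun θ => ?_)
    (integrable_logSumExp_normField hβ s (p θ) (q θ) c)
    (F' := fun θ W => ∑ x, gibbs β (normField s (p θ) (q θ) c W) x *
        (s * (∑ a, rowsDot W (p θ x) a / smoothNorm (rowsDot W (p θ x)) * rowsDot W (p' θ x) a
          + rowDot W none (q' θ x)))) ?_
    (ae_of_all _ fun W θ _ => ?_) ?_ (ae_of_all _ fun W θ _ => ?_)).2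
  · exact (integrable_logSumExp_normField hβ s (p θ) (q θ) c).1
  · refine Continuous.aestronglyMeasurable ?_
    refine continuous_finsetSum _ fun x _ => ?_
    refine (continuous_gibbs β (fun y => continuous_normField s _ _ c y) x).mul ?_
    refine continuous_const.mul ((continuous_finsetSum _ fun a _ => ?_).add
      (continuous_rowDot none _))
    exact ((continuous_rowsDot _ a).div (continuous_smoothNorm_rowsDot _)
      fun W => (smoothNorm_pos _).ne').mul (continuous_rowsDot _ a)
  · rw [Real.norm_eq_abs]
    refine (Finset.abs_sum_le_sum_abs _ _).trans (Finset.sum_le_sum fun x _ => ?_)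
    rw [abs_mul, abs_mul]
    gcongr
    · exact abs_gibbs_le_one _ _ _
    · refine (abs_add_le _ _).trans (add_le_add ?_ (abs_rowDot_le W none (hqM θ x) hM))
      refine (Finset.abs_sum_le_sum_abs _ _).trans (Finset.sum_le_sum fun a _ => ?_)
      rw [abs_mul]
      gcongr
      · exact abs_div_smoothNorm_le_one _ _
      · exact abs_rowDot_le W (some a) (hpM θ x) hM
  · have : Integrable (fun W : Option α × J → ℝ => ∑ i, |W i|)
        (stdGaussianPi (Option α × J)) :=
      integrable_finsetSum _ fun i _ => (integrable_eval_stdGaussianPi i).abs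
    fun_prop
  · exact hasDerivAt_logSumExp hβ fun x => hasDerivAt_normField s c (hp θ) (hq θ) W x

/-- The vector with coordinates `a * u j` and one additional coordinate `b`. -/
def joinVec (a : ℝ) (u : J → ℝ) (b : ℝ) : Option J → ℝ
  | none => b
  | some j => a * u j

lemma sum_joinVec_mul_joinVec (a a' b b' : ℝ) (u u' : J → ℝ) :
    ∑ j, joinVec a u b j * joinVec a' u' b' j = b * b' + a * a' * ∑ j, u j * u' j := by
  rw [Fintype.sum_option, Finset.mul_sum]
  simp only [joinVec]
  congr 1
  exact Finset.sum_congr rfl fun j _ => by ring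

lemma hasDerivAt_joinVec {a b : ℝ → ℝ} {a' b' θ : ℝ} (ha : HasDerivAt a a' θ)
    (hb : HasDerivAt b b' θ) (u : J → ℝ) (j : Option J) :
    HasDerivAt (fun θ => joinVec (a θ) u (b θ) j) (joinVec a' u b' j) θ := by
  cases j with
  | none => exact hb
  | some j => exact ha.mul_const (u j)

/-- Gordon's comparison inequality for the smoothed fields `± (‖G u‖ + γ ‖u‖)` and
`± (‖u‖ ‖g‖ + ⟨h, u⟩)`. -/
theorem integral_logSumExp_normField_le [Nonempty K] {β s : ℝ} (hβ : 0 < β) (hs : s ^ 2 = 1)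
    (u : K → J → ℝ) (r : K → ℝ) (hr : ∀ x, 0 ≤ r x) (hur : ∀ x, r x ^ 2 = ∑ j, u x j ^ 2)
    (c : K → ℝ) :
    ∫ W : Option α × Option J → ℝ, logSumExp β (normField s (fun x => joinVec 1 (u x) 0)
        (fun x => joinVec 0 (u x) (r x)) c W) ∂(stdGaussianPi (Option α × Option J))
      ≤ ∫ W : Option α × Option J → ℝ, logSumExp β (normField s (fun x => joinVec 0 (u x) (r x))
        (fun x => joinVec 1 (u x) 0) c W) ∂(stdGaussianPi (Option α × Option J)) := by
  set M : ℝ := ∑ x, (r x + ∑ j, |u x j|) with hMdef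
  have hM0 : ∀ x, r x + ∑ j, |u x j| ≤ M := fun x =>
    Finset.single_le_sum (f := fun x => r x + ∑ j, |u x j|)
      (fun x _ => add_nonneg (hr x) (by positivity)) (Finset.mem_univ x)
  have hM : 0 ≤ M := Finset.sum_nonneg fun x _ => add_nonneg (hr x) (by positivity)
  have hbd : ∀ (a b : ℝ) (x : K) (j : Option J), |a| ≤ 1 → |b| ≤ 1 →
      |joinVec a (u x) (b * r x) j| ≤ M := by
    intro a b x j ha hb
    refine le_trans ?_ (hM0 x)
    cases j with
    | none =>
      simp only [joinVec, abs_mul, abs_of_nonneg (hr x)]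
      have : 0 ≤ ∑ j, |u x j| := by positivity
      nlinarith [hr x]
    | some j =>
      simp only [joinVec, abs_mul]
      have : |u x j| ≤ ∑ j, |u x j| := Finset.single_le_sum (f := fun j => |u x j|)
        (fun _ _ => abs_nonneg _) (Finset.mem_univ j)
      nlinarith [hr x, abs_nonneg (u x j)]
  have hd := hasDerivAt_integral_logSumExp (α := α) hβ s
    (p := fun θ x => joinVec (Real.cos θ) (u x) (Real.sin θ * r x))
    (q := fun θ x => joinVec (Real.sin θ) (u x) (Real.cos θ * r x))
    (p' := fun θ x => joinVec (-Real.sin θ) (u x) (Real.cos θ * r x))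
    (q' := fun θ x => joinVec (Real.cos θ) (u x) (-Real.sin θ * r x)) c hM
    (fun θ x j => hasDerivAt_joinVec (Real.hasDerivAt_cos θ)
      ((Real.hasDerivAt_sin θ).mul_const (r x)) (u x) j)
    (fun θ x j => hasDerivAt_joinVec (Real.hasDerivAt_sin θ)
      ((Real.hasDerivAt_cos θ).mul_const (r x)) (u x) j)
    (fun θ x j => hbd _ _ x j (by rw [abs_neg]; exact Real.abs_sin_le_one θ)
      (Real.abs_cos_le_one θ))
    (fun θ x j => hbd _ _ x j (Real.abs_cos_le_one θ)
      (by rw [abs_neg]; exact Real.abs_sin_le_one θ))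
  have hmono := monotoneOn_of_deriv_nonneg (convex_Icc 0 (Real.pi / 2))
    (fun θ _ => (hd θ).continuousAt.continuousWithinAt)
    (fun θ _ => (hd θ).differentiableAt.differentiableWithinAt) (fun θ hθ => by
      rw [(hd θ).deriv]
      rw [interior_Icc] at hθ
      have hsin : 0 ≤ Real.sin θ :=
        Real.sin_nonneg_of_nonneg_of_le_pi hθ.1.le (by linarith [hθ.2, Real.pi_pos])
      have hcos : 0 ≤ Real.cos θ :=
        Real.cos_nonneg_of_neg_pi_div_two_le_of_le (by linarith [hθ.1, Real.pi_pos]) hθ.2.le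
      refine integral_gibbs_mul_deriv_nonneg hβ.le hs _ _ _ _ c
        (fun x y => Real.sin θ * Real.cos θ * (r x * r y - ∑ j, u y j * u x j))
        (fun x y => ?_) (fun x y => ?_) (fun x y => ?_) fun x => ?_
      · rw [sum_joinVec_mul_joinVec]; ring
      · rw [sum_joinVec_mul_joinVec]; ring
      · refine mul_nonneg (mul_nonneg hsin hcos) (sub_nonneg.2 ?_)
        refine (Real.sum_mul_le_sqrt_mul_sqrt _ _ _).trans ?_
        rw [← hur, ← hur, Real.sqrt_sq (hr x), Real.sqrt_sq (hr y), mul_comm]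
      · have : ∑ j, u x j * u x j = r x ^ 2 := by
          rw [hur]; exact Finset.sum_congr rfl fun j _ => by ring
        rw [this]; ring)
  have hpi := Real.pi_pos
  have := hmono (Set.left_mem_Icc.2 (by positivity)) (Set.right_mem_Icc.2 (by positivity))
    (by positivity : (0 : ℝ) ≤ Real.pi / 2)
  simpa using this

end SmoothMaximum

section SupportFunction

variable {N : ℕ} {S : Set (EuclideanSpace ℝ (Fin N))}

/-- The support function of a set, evaluated at a vector given by its coordinates. -/
noncomputable def supportFun (S : Set (EuclideanSpace ℝ (Fin N))) (g : Fin N → ℝ) : ℝ :=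
  sSup ((fun a : EuclideanSpace ℝ (Fin N) => ∑ i, g i * a i) '' S)

lemma abs_sum_mul_le (g : Fin N → ℝ) {a : EuclideanSpace ℝ (Fin N)} (ha : ‖a‖ ≤ 1) :
    |∑ i, g i * a i| ≤ ∑ i, |g i| := by
  refine (Finset.abs_sum_le_sum_abs _ _).trans (Finset.sum_le_sum fun i _ => ?_)
  rw [abs_mul]
  exact mul_le_of_le_one_right (abs_nonneg _) ((PiLp.norm_apply_le a i).trans ha)

lemma sum_mul_le_supportFun (hS : ∀ a ∈ S, ‖a‖ ≤ 1) (g : Fin N → ℝ)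
    {a : EuclideanSpace ℝ (Fin N)} (ha : a ∈ convexHull ℝ S) :
    ∑ i, g i * a i ≤ supportFun S g := by
  have hb : BddAbove ((fun a : EuclideanSpace ℝ (Fin N) => ∑ i, g i * a i) '' S) := by
    refine ⟨∑ i, |g i|, ?_⟩
    rintro _ ⟨a, ha, rfl⟩
    exact (le_abs_self _).trans (abs_sum_mul_le g (hS a ha))
  have hlin : IsLinearMap ℝ fun a : EuclideanSpace ℝ (Fin N) => ∑ i, g i * a i :=
    ⟨fun x y => by simp [mul_add, Finset.sum_add_distrib],
      fun c x => by simp [Finset.mul_sum, mul_left_comm]⟩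
  exact convexHull_min (fun x hx => le_csSup hb ⟨x, hx, rfl⟩)
    (convex_halfSpace_le hlin (supportFun S g)) ha

lemma neg_mem_convexHull (hneg : ∀ a ∈ S, -a ∈ S) {a : EuclideanSpace ℝ (Fin N)}
    (ha : a ∈ convexHull ℝ S) : -a ∈ convexHull ℝ S := by
  have h : -S ⊆ S := fun x hx => by simpa using hneg _ hx
  have h2 := convexHull_mono (𝕜 := ℝ) h
  rw [convexHull_neg] at h2
  exact h2 (by simpa using ha)

lemma abs_sum_mul_le_supportFun (hS : ∀ a ∈ S, ‖a‖ ≤ 1) (hneg : ∀ a ∈ S, -a ∈ S)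
    (g : Fin N → ℝ) {a : EuclideanSpace ℝ (Fin N)} (ha : a ∈ convexHull ℝ S) :
    |∑ i, g i * a i| ≤ supportFun S g := by
  refine abs_le'.2 ⟨sum_mul_le_supportFun hS g ha, ?_⟩
  simpa using sum_mul_le_supportFun hS g (neg_mem_convexHull hneg ha)

lemma supportFun_le_add (hne : S.Nonempty) (hS : ∀ a ∈ S, ‖a‖ ≤ 1) (g h : Fin N → ℝ) :
    supportFun S g ≤ supportFun S h + ∑ i, |g i - h i| := by
  refine csSup_le (hne.image _) ?_
  rintro _ ⟨a, ha, rfl⟩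
  have h1 := sum_mul_le_supportFun hS h (subset_convexHull ℝ S ha)
  have h2 := (le_abs_self _).trans (abs_sum_mul_le (fun i => g i - h i) (hS a ha))
  simp only [sub_mul, Finset.sum_sub_distrib] at h2
  dsimp only
  linarith

lemma continuous_supportFun (hne : S.Nonempty) (hS : ∀ a ∈ S, ‖a‖ ≤ 1) :
    Continuous (supportFun S) := by
  refine continuous_iff_continuousAt.2 fun g => ?_
  rw [ContinuousAt, tendsto_iff_dist_tendsto_zero]
  have hc : Continuous fun h : Fin N → ℝ => ∑ i, |h i - g i| := by fun_prop
  have h0 : Filter.Tendsto (fun h : Fin N → ℝ => ∑ i, |h i - g i|) (nhds g) (nhds 0) := by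
    simpa using hc.tendsto g
  refine squeeze_zero (fun _ => dist_nonneg) (fun h => ?_) h0
  have h1 := supportFun_le_add hne hS h g
  have h2 := supportFun_le_add hne hS g h
  simp only [abs_sub_comm (g _) (h _)] at h2
  rw [Real.dist_eq, abs_le]
  constructor <;> linarith

lemma integrable_supportFun (hne : S.Nonempty) (hS : ∀ a ∈ S, ‖a‖ ≤ 1) :
    Integrable (supportFun S) (stdGaussianPi (Fin N)) := by
  refine integrable_of_linear_growth (continuous_supportFun hne hS)
    (A := |supportFun S 0|) (B := 1) fun g => ?_
  have h1 := supportFun_le_add hne hS g 0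
  have h2 := supportFun_le_add hne hS 0 g
  simp only [Pi.zero_apply, sub_zero, zero_sub, abs_neg] at h1 h2
  have h3 := abs_le.1 (le_refl |supportFun S 0|)
  rw [abs_le]
  constructor <;> linarith

lemma gaussianWidth_nonneg (hne : S.Nonempty) (hS : ∀ a ∈ S, ‖a‖ ≤ 1) (hneg : ∀ a ∈ S, -a ∈ S) :
    0 ≤ gaussianWidth S := by
  obtain ⟨a, ha⟩ := hne
  exact integral_nonneg fun g =>
    (abs_nonneg _).trans (abs_sum_mul_le_supportFun hS hneg g (subset_convexHull ℝ S ha))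

lemma zero_mem_convexHull (hne : S.Nonempty) (hneg : ∀ a ∈ S, -a ∈ S) : 0 ∈ convexHull ℝ S := by
  obtain ⟨a, ha⟩ := hne
  have := (convex_convexHull ℝ S) (subset_convexHull ℝ S ha) (subset_convexHull ℝ S (hneg a ha))
    (by norm_num : (0 : ℝ) ≤ 1 / 2) (by norm_num : (0 : ℝ) ≤ 1 / 2) (by norm_num)
  simpa using this

lemma norm_le_one_of_mem_convexHull (hS : ∀ a ∈ S, ‖a‖ ≤ 1) {a : EuclideanSpace ℝ (Fin N)}
    (ha : a ∈ convexHull ℝ S) : ‖a‖ ≤ 1 := by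
  have h : S ⊆ Metric.closedBall 0 1 := fun x hx => by simpa using hS x hx
  simpa using convexHull_min h (convex_closedBall 0 1) ha

end SupportFunction

section UnitSecants

variable {N : ℕ} {X : Set (EuclideanSpace ℝ (Fin N))}

lemma unitSecants_nonempty (hX : X.Nontrivial) : (unitSecants X).Nonempty := by
  obtain ⟨x, hx, y, hy, hxy⟩ := hX
  exact ⟨_, subset_closure ⟨x, hx, y, hy, hxy, rfl⟩⟩

lemma neg_mem_unitSecants : ∀ a ∈ unitSecants X, -a ∈ unitSecants X := by
  intro a ha
  refine map_mem_closure continuous_neg ha ?_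
  rintro _ ⟨x, hx, y, hy, hxy, rfl⟩
  exact ⟨y, hy, x, hx, hxy.symm, by rw [norm_sub_rev, ← smul_neg, neg_sub]⟩

lemma norm_le_one_of_mem_unitSecants : ∀ a ∈ unitSecants X, ‖a‖ ≤ 1 := by
  intro a ha
  have h : unitSecants X ⊆ Metric.closedBall 0 1 := by
    refine closure_minimal ?_ Metric.isClosed_closedBall
    rintro _ ⟨x, -, y, -, hxy, rfl⟩
    simp [norm_smul, inv_mul_cancel₀ (norm_ne_zero_iff.2 (sub_ne_zero.2 hxy))]
  simpa using h ha

end UnitSecants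

section GaussianNorm

lemma integrable_sq_gaussianReal : Integrable (fun t : ℝ => t ^ 2) (gaussianReal 0 1) :=
  ((memLp_id_gaussianReal (μ := 0) (v := 1) 2)).integrable_sq

lemma integral_sq_gaussianReal : ∫ t, t ^ 2 ∂(gaussianReal 0 1) = 1 := by
  have h := variance_fun_id_gaussianReal (μ := 0) (v := 1)
  rw [variance_eq_integral (by fun_prop)] at h
  simpa [integral_id_gaussianReal] using h

variable {ι : Type*} [Fintype ι]

lemma integrable_sq_eval_stdGaussianPi (i : ι) :
    Integrable (fun w : ι → ℝ => w i ^ 2) (stdGaussianPi ι) :=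
  (measurePreserving_eval (fun _ : ι => gaussianReal 0 1) i).integrable_comp_of_integrable
    integrable_sq_gaussianReal

lemma integral_sq_eval_stdGaussianPi (i : ι) :
    ∫ w : ι → ℝ, w i ^ 2 ∂(stdGaussianPi ι) = 1 := by
  have h := measurePreserving_eval (fun _ : ι => gaussianReal 0 1) i
  rw [← integral_sq_gaussianReal, ← h.map_eq,
    integral_map (measurable_pi_apply i).aemeasurable (by fun_prop)]

lemma integral_abs_eval_stdGaussianPi_le (i : ι) :
    ∫ w : ι → ℝ, |w i| ∂(stdGaussianPi ι) ≤ 1 := by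
  have h : ∫ w : ι → ℝ, |w i| ∂(stdGaussianPi ι)
      ≤ ∫ w : ι → ℝ, (1 + w i ^ 2) / 2 ∂(stdGaussianPi ι) := by
    refine integral_mono (integrable_eval_stdGaussianPi i).abs
      (((integrable_const 1).add (integrable_sq_eval_stdGaussianPi i)).div_const 2) fun w => ?_
    have := sq_abs (w i)
    have := sq_nonneg (|w i| - 1)
    dsimp only
    nlinarith
  rw [integral_div, integral_add (integrable_const 1) (integrable_sq_eval_stdGaussianPi i),
    integral_sq_eval_stdGaussianPi] at h
  simpa using h

lemma abs_sqrt_sub_sqrt_le {t m : ℝ} (ht : 0 ≤ t) (hm : 0 < m) :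
    |√t - √m| ≤ ((t - m) ^ 2 / m + 1) / 2 := by
  have h1 : 0 < √m := Real.sqrt_pos.2 hm
  have h2 : |√t - √m| * √m ≤ |t - m| := by
    have : t - m = (√t - √m) * (√t + √m) := by
      nlinarith [Real.sq_sqrt ht, Real.sq_sqrt hm.le]
    rw [this, abs_mul]
    refine mul_le_mul_of_nonneg_left ?_ (abs_nonneg _)
    exact (le_add_of_nonneg_left (Real.sqrt_nonneg t)).trans (le_abs_self _)
  have h3 : |√t - √m| ≤ |t - m| / √m := (le_div_iff₀ h1).2 h2
  have h4 : (t - m) ^ 2 / m = (|t - m| / √m) ^ 2 := by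
    rw [div_pow, sq_abs, Real.sq_sqrt hm.le]
  rw [h4]
  nlinarith [sq_nonneg (|t - m| / √m - 1)]

/-- The norm of a standard Gaussian vector in dimension `m` is within `O(1)` of `√m` in mean. -/
lemma exists_integral_abs_norm_sub_sqrt_le : ∃ c : ℝ, 0 ≤ c ∧ ∀ m : ℕ, 0 < m →
    ∫ w : Fin m → ℝ, |√(∑ a, w a ^ 2) - √m| ∂(stdGaussianPi (Fin m)) ≤ c := by
  have hL : MemLp (fun t : ℝ => t ^ 2) 2 (gaussianReal 0 1) := by
    rw [memLp_two_iff_integrable_sq (by fun_prop)]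
    have := (memLp_id_gaussianReal (μ := 0) (v := 1) 4).integrable_norm_pow (by simp)
    refine this.congr (ae_of_all _ fun t => ?_)
    simp [← pow_mul, Even.pow_abs (show Even 4 by decide)]
  set v := variance (fun t : ℝ => t ^ 2) (gaussianReal 0 1)
  have hv : 0 ≤ v := variance_nonneg _ _
  refine ⟨(v + 1) / 2, by positivity, fun m hm => ?_⟩
  have hm' : (0 : ℝ) < m := by exact_mod_cast hm
  have hsum : MemLp (fun w : Fin m → ℝ => ∑ a, w a ^ 2) 2 (stdGaussianPi (Fin m)) :=
    memLp_finsetSum _ fun a _ =>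
      hL.comp_measurePreserving (measurePreserving_eval (fun _ : Fin m => gaussianReal 0 1) a)
  have hvar := variance_sum_pi (μ := fun _ : Fin m => gaussianReal 0 1)
    (X := fun _ t => t ^ 2) (fun _ => hL)
  have hmean : ∫ w : Fin m → ℝ, ∑ a, w a ^ 2 ∂(stdGaussianPi (Fin m)) = m := by
    rw [integral_finsetSum _ fun a _ => integrable_sq_eval_stdGaussianPi a]
    simp [integral_sq_eval_stdGaussianPi]
  have hvar2 : ∫ w : Fin m → ℝ, (∑ a, w a ^ 2 - (m : ℝ)) ^ 2 ∂(stdGaussianPi (Fin m)) = m * v := by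
    have e : (∑ i : Fin m, fun ω : Fin m → ℝ => (fun t : ℝ => t ^ 2) (ω i))
        = fun w : Fin m → ℝ => ∑ a, w a ^ 2 := by ext w; simp
    rw [e, variance_eq_integral hsum.1.aemeasurable, hmean] at hvar
    rw [hvar]
    simp [v]
  have hint : Integrable (fun w : Fin m → ℝ => (∑ a, w a ^ 2 - (m : ℝ)) ^ 2)
      (stdGaussianPi (Fin m)) := (hsum.sub (memLp_const _)).integrable_sq
  calc ∫ w : Fin m → ℝ, |√(∑ a, w a ^ 2) - √m| ∂(stdGaussianPi (Fin m))
      ≤ ∫ w : Fin m → ℝ, ((∑ a, w a ^ 2 - (m : ℝ)) ^ 2 / m + 1) / 2 ∂(stdGaussianPi (Fin m)) := by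
        refine integral_mono_of_nonneg (ae_of_all _ fun _ => abs_nonneg _)
          (((hint.div_const _).add (integrable_const 1)).div_const 2) (ae_of_all _ fun w => ?_)
        exact abs_sqrt_sub_sqrt_le (by positivity) hm'
    _ = (v + 1) / 2 := by
        rw [integral_div, integral_add (hint.div_const _) (integrable_const 1), integral_div, hvar2,
          mul_div_cancel_left₀ _ hm'.ne']
        simp

end GaussianNorm

section RandomMatrix

variable {m N : ℕ} {S : Set (EuclideanSpace ℝ (Fin N))}

lemma norm_mulVecE (Φ : Matrix (Fin m) (Fin N) ℝ) (x : EuclideanSpace ℝ (Fin N)) :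
    ‖mulVecE Φ x‖ = √(∑ a, (∑ j, Φ a j * x j) ^ 2) := by
  rw [EuclideanSpace.norm_eq]
  simp [mulVecE, Matrix.mulVec, dotProduct]

lemma mulVecE_sub (Φ : Matrix (Fin m) (Fin N) ℝ) (x y : EuclideanSpace ℝ (Fin N)) :
    mulVecE Φ (x - y) = mulVecE Φ x - mulVecE Φ y := by
  simp [mulVecE, Matrix.mulVec_sub]

lemma norm_mulVecE_smul (t : ℝ) (Φ : Matrix (Fin m) (Fin N) ℝ) (x : EuclideanSpace ℝ (Fin N)) :
    ‖mulVecE (t • Φ) x‖ = |t| * ‖mulVecE Φ x‖ := by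
  have : mulVecE (t • Φ) x = t • mulVecE Φ x := by
    simp [mulVecE, Matrix.smul_mulVec]
  rw [this, norm_smul, Real.norm_eq_abs]

lemma norm_mulVecE_le (Φ : Matrix (Fin m) (Fin N) ℝ) (x : EuclideanSpace ℝ (Fin N)) :
    ‖mulVecE Φ x‖ ≤ √(∑ a, ∑ j, Φ a j ^ 2) * ‖x‖ := by
  rw [norm_mulVecE, EuclideanSpace.norm_eq, ← Real.sqrt_mul (by positivity), Finset.sum_mul]
  refine Real.sqrt_le_sqrt (Finset.sum_le_sum fun a _ => ?_)
  simpa using Finset.sum_mul_sq_le_sq_mul_sq Finset.univ (Φ a) x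

lemma mul_le_abs_of_sq_eq_one {s : ℝ} (hs : s ^ 2 = 1) (t : ℝ) : s * t ≤ |t| := by
  have h : |s| = 1 := by rwa [← abs_one, ← sq_eq_sq_iff_abs_eq_abs, one_pow]
  calc s * t ≤ |s * t| := le_abs_self _
    _ = |t| := by rw [abs_mul, h, one_mul]

/-- The smoothed supremum over `F` of `s * (‖G x‖ + γ ‖x‖ - √m ‖x‖)`, where the matrix `G` and the
number `γ` are parts of the array `W`. -/
noncomputable def smoothDeviation (F : Finset (EuclideanSpace ℝ (Fin N))) (s : ℝ)
    (W : Option (Fin m) × Option (Fin N) → ℝ) : ℝ :=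
  logSumExp (1 + Real.log (Fintype.card F)) (normField s
    (fun x : F => joinVec 1 x.1 0) (fun x : F => joinVec 0 x.1 ‖x.1‖)
    (fun x : F => -(s * (√m * ‖x.1‖))) W)

/-- The matrix part of a Gaussian array. -/
def matrixPart (W : Option (Fin m) × Option (Fin N) → ℝ) : Matrix (Fin m) (Fin N) ℝ :=
  Matrix.of fun a j => W (some a, some j)

lemma one_le_one_add_log_card (F : Finset (EuclideanSpace ℝ (Fin N))) :
    1 ≤ 1 + Real.log (Fintype.card F) := by
  have := Real.log_natCast_nonneg (Fintype.card F)
  linarith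

lemma le_smoothDeviation {F : Finset (EuclideanSpace ℝ (Fin N))} {s : ℝ} (hs : s ^ 2 = 1)
    (W : Option (Fin m) × Option (Fin N) → ℝ) {x : EuclideanSpace ℝ (Fin N)} (hx : x ∈ F)
    (hx1 : ‖x‖ ≤ 1) :
    s * (‖mulVecE (matrixPart W) x‖ - √m * ‖x‖)
      ≤ smoothDeviation F s W + 1 + |W (none, none)| := by
  have hβ : 0 < 1 + Real.log (Fintype.card F) := by linarith [one_le_one_add_log_card F]
  refine le_trans ?_ (add_le_add_left (add_le_add_left (le_logSumExp hβ _ ⟨x, hx⟩) _) _)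
  have e1 : rowsDot W (joinVec 1 x 0) = fun a => ∑ j, matrixPart W a j * x j := by
    ext a
    simp [rowsDot, rowDot, Fintype.sum_option, joinVec, matrixPart]
  have e2 : rowDot W none (joinVec 0 x ‖x‖) = W (none, none) * ‖x‖ := by
    simp [rowDot, Fintype.sum_option, joinVec]
  simp only [normField, e1, e2]
  have l1 := sqrt_le_smoothNorm (fun a => ∑ j, matrixPart W a j * x j)
  have l2 := smoothNorm_le (fun a => ∑ j, matrixPart W a j * x j)
  rw [← norm_mulVecE] at l1 l2
  have l3 : |W (none, none) * ‖x‖| ≤ |W (none, none)| := by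
    rw [abs_mul, abs_norm]
    exact mul_le_of_le_one_right (abs_nonneg _) hx1
  set t := smoothNorm (fun a => ∑ j, matrixPart W a j * x j)
  have l4 := mul_le_abs_of_sq_eq_one hs (‖mulVecE (matrixPart W) x‖ - t - W (none, none) * ‖x‖)
  have l5 : |‖mulVecE (matrixPart W) x‖ - t - W (none, none) * ‖x‖| ≤ 1 + |W (none, none)| := by
    refine (abs_sub _ _).trans (add_le_add ?_ l3)
    rw [abs_le]
    constructor <;> linarith
  linarith

lemma integrable_smoothDeviation {F : Finset (EuclideanSpace ℝ (Fin N))} (hF : F.Nonempty)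
    (s : ℝ) : Integrable (smoothDeviation (m := m) F s)
      (stdGaussianPi (Option (Fin m) × Option (Fin N))) := by
  have : Nonempty F := hF.to_subtype
  exact integrable_logSumExp_normField (by linarith [one_le_one_add_log_card F]) _ _ _ _

lemma integral_smoothDeviation_le (hne : S.Nonempty) (hS : ∀ a ∈ S, ‖a‖ ≤ 1)
    (hneg : ∀ a ∈ S, -a ∈ S) {F : Finset (EuclideanSpace ℝ (Fin N))} (hF : F.Nonempty)
    (hFS : ∀ x ∈ F, x ∈ convexHull ℝ S) {s : ℝ} (hs : s ^ 2 = 1) :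
    ∫ W, smoothDeviation (m := m) F s W ∂(stdGaussianPi (Option (Fin m) × Option (Fin N)))
      ≤ gaussianWidth S + ∫ g : Fin m → ℝ, |√(∑ a, g a ^ 2) - √m| ∂(stdGaussianPi (Fin m))
        + 2 := by
  have : Nonempty F := hF.to_subtype
  have hβ1 := one_le_one_add_log_card F
  have hβ : 0 < 1 + Real.log (Fintype.card F) := by linarith
  have mp1 := measurePreserving_precomp_stdGaussianPi
    (e := fun a : Fin m => ((some a, none) : Option (Fin m) × Option (Fin N)))
    (fun a b h => by simpa using h)
  have mp2 := measurePreserving_precomp_stdGaussianPi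
    (e := fun j : Fin N => ((none, some j) : Option (Fin m) × Option (Fin N)))
    (fun a b h => by simpa using h)
  have c1 : Continuous fun g : Fin m → ℝ => |√(∑ a, g a ^ 2) - √m| := by fun_prop
  have i1 : Integrable (fun g : Fin m → ℝ => |√(∑ a, g a ^ 2) - √m|) (stdGaussianPi (Fin m)) := by
    refine integrable_of_linear_growth c1 (A := √m) (B := 1) fun g => ?_
    rw [abs_abs]
    refine (abs_sub _ _).trans ?_
    rw [abs_of_nonneg (Real.sqrt_nonneg _), abs_of_nonneg (Real.sqrt_nonneg _), one_mul, add_comm]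
    exact add_le_add_right (sqrt_sum_sq_le_sum_abs g) _
  have i2 := integrable_supportFun hne hS
  have i1' := mp1.integrable_comp_of_integrable i1
  have i2' := mp2.integrable_comp_of_integrable i2
  have E1 : ∫ W : Option (Fin m) × Option (Fin N) → ℝ, |√(∑ a, W (some a, none) ^ 2) - √m|
      ∂(stdGaussianPi _) = ∫ g : Fin m → ℝ, |√(∑ a, g a ^ 2) - √m| ∂(stdGaussianPi (Fin m)) := by
    conv_rhs => rw [← mp1.map_eq]
    rw [integral_map mp1.measurable.aemeasurable c1.aestronglyMeasurable]
  have E2 : ∫ W : Option (Fin m) × Option (Fin N) → ℝ, supportFun S (fun j => W (none, some j))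
      ∂(stdGaussianPi _) = gaussianWidth S := by
    change _ = ∫ h, supportFun S h ∂(stdGaussianPi (Fin N))
    conv_rhs => rw [← mp2.map_eq]
    rw [integral_map mp2.measurable.aemeasurable
      (continuous_supportFun hne hS).aestronglyMeasurable]
  refine (integral_logSumExp_normField_le hβ hs
    (fun x : F => (x.1 : Fin N → ℝ)) (fun x : F => ‖x.1‖) (fun _ => norm_nonneg _)
    (fun x => EuclideanSpace.real_norm_sq_eq _) _).trans ?_
  refine (integral_mono (g := fun W : Option (Fin m) × Option (Fin N) → ℝ =>
    supportFun S (fun j => W (none, some j)) + |√(∑ a, W (some a, none) ^ 2) - √m| + 2)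
    (integrable_logSumExp_normField hβ _ _ _ _) ((i2'.add i1').add (integrable_const 2))
    fun W => ?_).trans_eq ?_
  · refine (logSumExp_le hβ (M := supportFun S (fun j => W (none, some j))
      + |√(∑ a, W (some a, none) ^ 2) - √m| + 1) _ ?_).trans ?_
    · rintro ⟨x, hx⟩
      have hx1 := norm_le_one_of_mem_convexHull hS (hFS x hx)
      have e1 : rowsDot W (joinVec 0 x ‖x‖) = fun a => W (some a, none) * ‖x‖ := by
        ext a
        simp [rowsDot, rowDot, Fintype.sum_option, joinVec]
      have e2 : rowDot W none (joinVec 1 x 0) = ∑ j, W (none, some j) * x j := by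
        simp [rowDot, Fintype.sum_option, joinVec]
      have e3 : √(∑ a, (W (some a, none) * ‖x‖) ^ 2) = √(∑ a, W (some a, none) ^ 2) * ‖x‖ := by
        simp only [mul_pow, ← Finset.sum_mul]
        rw [Real.sqrt_mul (by positivity), Real.sqrt_sq (norm_nonneg x)]
      simp only [normField, e1, e2]
      have l1 := sqrt_le_smoothNorm (fun a => W (some a, none) * ‖x‖)
      have l2 := smoothNorm_le (fun a => W (some a, none) * ‖x‖)
      rw [e3] at l1 l2
      set t := smoothNorm (fun a => W (some a, none) * ‖x‖)
      set n := √(∑ a, W (some a, none) ^ 2)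
      have l3 := (mul_le_abs_of_sq_eq_one hs _).trans
        (abs_sum_mul_le_supportFun hS hneg (fun j => W (none, some j)) (hFS x hx))
      have l4 : s * ((n - √m) * ‖x‖) ≤ |n - √m| := by
        refine (mul_le_abs_of_sq_eq_one hs _).trans ?_
        rw [abs_mul, abs_norm]
        exact mul_le_of_le_one_right (abs_nonneg _) hx1
      have l5 : s * (t - n * ‖x‖) ≤ 1 := by
        refine (mul_le_abs_of_sq_eq_one hs _).trans (abs_le.2 ?_)
        constructor <;> linarith
      linarith
    · have : Real.log (Fintype.card F) / (1 + Real.log (Fintype.card F)) ≤ 1 :=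
        (div_le_one hβ).2 (by linarith)
      linarith
  · exact (integral_add (i2'.add i1') (integrable_const 2)).trans
      (congrArg₂ _ ((integral_add i2' i1').trans (congrArg₂ _ E2 E1)) (by simp))

/-- On a finite set, some matrix of controlled size distorts norms by a bounded amount. -/
lemma exists_matrix_of_finset (hne : S.Nonempty) (hS : ∀ a ∈ S, ‖a‖ ≤ 1)
    (hneg : ∀ a ∈ S, -a ∈ S) {F : Finset (EuclideanSpace ℝ (Fin N))}
    (h0 : 0 ∈ F) (hFS : ∀ x ∈ F, x ∈ convexHull ℝ S) {c : ℝ}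
    (hc : ∫ g : Fin m → ℝ, |√(∑ a, g a ^ 2) - √m| ∂(stdGaussianPi (Fin m)) ≤ c) :
    ∃ G : Matrix (Fin m) (Fin N) ℝ,
      (∀ x ∈ F, |‖mulVecE G x‖ - √m * ‖x‖| ≤ 2 * gaussianWidth S + 2 * c + 9) ∧
      ∑ a, ∑ j, G a j ^ 2 ≤ (2 * gaussianWidth S + 2 * c + 9) * ((m + 1) * (N + 1)) := by
  set B := 2 * gaussianWidth S + 2 * c + 9
  have hF : F.Nonempty := ⟨0, h0⟩
  set κ : ℝ := (m + 1) * (N + 1)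
  have hκ : 0 < κ := by positivity
  have j1 := integrable_smoothDeviation (m := m) hF 1
  have j2 := integrable_smoothDeviation (m := m) hF (-1)
  have j3 := (integrable_eval_stdGaussianPi
    ((none, none) : Option (Fin m) × Option (Fin N))).abs
  have j4 : Integrable (fun W : Option (Fin m) × Option (Fin N) → ℝ => (∑ i, W i ^ 2) / κ)
      (stdGaussianPi _) :=
    (integrable_finsetSum _ fun i _ => integrable_sq_eval_stdGaussianPi i).div_const κ
  have k1 := integral_smoothDeviation_le (m := m) hne hS hneg hF hFS (s := 1) (by norm_num)
  have k2 := integral_smoothDeviation_le (m := m) hne hS hneg hF hFS (s := -1) (by norm_num)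
  have k3 := integral_abs_eval_stdGaussianPi_le
    ((none, none) : Option (Fin m) × Option (Fin N))
  have k4 : ∫ W : Option (Fin m) × Option (Fin N) → ℝ, (∑ i, W i ^ 2) / κ
      ∂(stdGaussianPi _) = 1 := by
    rw [integral_div, integral_finsetSum _ fun i _ => integrable_sq_eval_stdGaussianPi i]
    simp only [integral_sq_eval_stdGaussianPi, Finset.sum_const, Finset.card_univ,
      Fintype.card_prod, Fintype.card_option, Fintype.card_fin, nsmul_eq_mul, mul_one]
    push_cast
    exact div_self hκ.ne'
  have j5 : Integrable (fun W : Option (Fin m) × Option (Fin N) → ℝ => 2 * (1 + |W (none, none)|))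
      (stdGaussianPi _) := ((integrable_const 1).add j3).const_mul 2
  have k5 : ∫ W : Option (Fin m) × Option (Fin N) → ℝ, 2 * (1 + |W (none, none)|)
      ∂(stdGaussianPi _) ≤ 4 := by
    rw [integral_const_mul, integral_add (integrable_const 1) j3]
    simp only [integral_const, probReal_univ, smul_eq_mul, mul_one]
    linarith
  obtain ⟨W, hW⟩ := exists_le_integral (((j1.add j2).add j5).add j4)
  rw [integral_add' ((j1.add j2).add j5) j4, integral_add' (j1.add j2) j5, integral_add' j1 j2,
    k4] at hW
  have hT : smoothDeviation F 1 W + smoothDeviation F (-1) W + 2 * (1 + |W (none, none)|)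
      + (∑ i, W i ^ 2) / κ ≤ B := hW.trans (by linarith)
  have n1 := le_smoothDeviation (s := 1) (by norm_num) W h0 (by simp)
  have n2 := le_smoothDeviation (s := -1) (by norm_num) W h0 (by simp)
  have hz : ‖mulVecE (matrixPart W) (0 : EuclideanSpace ℝ (Fin N))‖ = 0 := by
    simp [norm_mulVecE]
  rw [hz, norm_zero] at n1 n2
  have n3 : 0 ≤ (∑ i, W i ^ 2) / κ := by positivity
  refine ⟨matrixPart W, fun x hx => ?_, ?_⟩
  · have hx1 := norm_le_one_of_mem_convexHull hS (hFS x hx)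
    have l1 := le_smoothDeviation (s := 1) (by norm_num) W hx hx1
    have l2 := le_smoothDeviation (s := -1) (by norm_num) W hx hx1
    rw [abs_le]
    constructor <;> linarith
  · have l1 : (∑ i, W i ^ 2) / κ ≤ B := by linarith
    rw [div_le_iff₀ hκ] at l1
    refine le_trans ?_ l1
    rw [Fintype.sum_prod_type, Fintype.sum_option]
    refine le_add_of_nonneg_of_le (by positivity) (Finset.sum_le_sum fun a _ => ?_)
    rw [Fintype.sum_option]
    exact le_add_of_nonneg_left (sq_nonneg _)

/-- Some `m × N` matrix distorts norms on the whole convex hull by a bounded amount. -/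
lemma exists_matrix_convexHull (hne : S.Nonempty) (hS : ∀ a ∈ S, ‖a‖ ≤ 1)
    (hneg : ∀ a ∈ S, -a ∈ S) {c : ℝ}
    (hc : ∫ g : Fin m → ℝ, |√(∑ a, g a ^ 2) - √m| ∂(stdGaussianPi (Fin m)) ≤ c) :
    ∃ G : Matrix (Fin m) (Fin N) ℝ, ∀ x ∈ convexHull ℝ S,
      |‖mulVecE G x‖ - √m * ‖x‖| ≤ 2 * gaussianWidth S + 2 * c + 10 := by
  set B := 2 * gaussianWidth S + 2 * c + 9
  set M := √(B * ((m + 1) * (N + 1))) + √m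
  have hM : 0 ≤ M := by positivity
  have htb : TotallyBounded (convexHull ℝ S) := by
    refine (isCompact_closedBall (0 : EuclideanSpace ℝ (Fin N)) 1).totallyBounded.subset
      fun x hx => ?_
    simpa using norm_le_one_of_mem_convexHull hS hx
  obtain ⟨t, htS, htf, hcov⟩ := Metric.finite_approx_of_totallyBounded htb (M + 1)⁻¹ (by positivity)
  obtain ⟨G, hG1, hG2⟩ := exists_matrix_of_finset (m := m) hne hS hneg
    (F := insert 0 htf.toFinset) (by simp) (fun x hx => by
      rcases Finset.mem_insert.1 hx with rfl | hx
      · exact zero_mem_convexHull hne hneg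
      · exact htS (htf.mem_toFinset.1 hx)) hc
  refine ⟨G, fun x hx => ?_⟩
  obtain ⟨y, hy, hxy⟩ := Set.mem_iUnion₂.1 (hcov hx)
  have l1 := hG1 y (by simp [hy])
  rw [Metric.mem_ball, dist_eq_norm] at hxy
  have l2 : |‖mulVecE G x‖ - ‖mulVecE G y‖| ≤ √(B * ((m + 1) * (N + 1))) * ‖x - y‖ :=
    calc |‖mulVecE G x‖ - ‖mulVecE G y‖| ≤ ‖mulVecE G (x - y)‖ := by
          rw [mulVecE_sub]; exact abs_norm_sub_norm_le _ _
      _ ≤ √(∑ a, ∑ j, G a j ^ 2) * ‖x - y‖ := norm_mulVecE_le G _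
      _ ≤ _ := by gcongr
  have l3 : |√m * ‖x‖ - √m * ‖y‖| ≤ √m * ‖x - y‖ := by
    rw [← mul_sub, abs_mul, abs_of_nonneg (Real.sqrt_nonneg _)]
    exact mul_le_mul_of_nonneg_left (abs_norm_sub_norm_le _ _) (Real.sqrt_nonneg _)
  have l4 : M * ‖x - y‖ ≤ 1 := by
    calc M * ‖x - y‖ ≤ (M + 1) * (M + 1)⁻¹ := by gcongr; linarith
      _ = 1 := mul_inv_cancel₀ (by positivity)
  rw [abs_le] at l1 l2 l3 ⊢
  rw [show M = √(B * ((m + 1) * (N + 1))) + √m from rfl, add_mul] at l4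
  constructor <;> linarith

end RandomMatrix

theorem stmt_7 :
    ∃ C : ℝ, 0 < C ∧ ∀ (N : ℕ) (X : Set (EuclideanSpace ℝ (Fin N))), X.Nontrivial →
      ∀ ε : ℝ, ε ∈ Set.Ioo (0 : ℝ) 1 →
      ∃ m : ℕ, (m : ℝ) ≤ C * ε⁻¹ ^ 2 * (gaussianWidth (unitSecants X) + 1) ^ 2 ∧
      ∃ Φ : Matrix (Fin m) (Fin N) ℝ, convexHullDistortion Φ ε (unitSecants X) := by
  obtain ⟨c, hc0, hc⟩ := exists_integral_abs_norm_sub_sqrt_le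
  refine ⟨2 * (2 * c + 10) ^ 2, by positivity, fun N X hX ε hε => ?_⟩
  obtain ⟨hε0, hε1⟩ := hε
  set S := unitSecants X
  have hne : S.Nonempty := unitSecants_nonempty hX
  have hw := gaussianWidth_nonneg hne norm_le_one_of_mem_unitSecants neg_mem_unitSecants
  set w := gaussianWidth S
  set D := (2 * c + 10) * (w + 1) with hD
  have hD1 : 1 ≤ D := by nlinarith [mul_nonneg hc0 hw]
  set m := ⌈(D / ε) ^ 2⌉₊
  have hDε : 1 ≤ D / ε := (one_le_div hε0).2 (by linarith)
  have hmpos : 0 < m := Nat.ceil_pos.2 (by positivity)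
  have hmle : (m : ℝ) ≤ 2 * (D / ε) ^ 2 := by
    have h1 := (Nat.ceil_lt_add_one (by positivity : 0 ≤ (D / ε) ^ 2)).le
    have h2 : 1 ≤ (D / ε) ^ 2 := one_le_pow₀ hDε
    change (⌈(D / ε) ^ 2⌉₊ : ℝ) ≤ _
    linarith
  have hsq : D / ε ≤ √m := Real.le_sqrt_of_sq_le (Nat.le_ceil _)
  have hsqpos : 0 < √m := by linarith
  refine ⟨m, hmle.trans_eq ?_, ?_⟩
  · rw [hD, div_eq_mul_inv]
    ring
  obtain ⟨G, hG⟩ := exists_matrix_convexHull (N := N) hne norm_le_one_of_mem_unitSecants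
    neg_mem_unitSecants (hc m hmpos)
  refine ⟨(√m)⁻¹ • G, fun x hx => ?_⟩
  have h1 : ‖mulVecE ((√m)⁻¹ • G) x‖ - ‖x‖ = (‖mulVecE G x‖ - √m * ‖x‖) / √m := by
    rw [norm_mulVecE_smul, abs_of_pos (inv_pos.2 hsqpos)]
    field_simp
  rw [h1, abs_div, abs_of_pos hsqpos, div_le_iff₀ hsqpos]
  refine (hG x hx).trans ?_
  rw [div_le_iff₀ hε0] at hsq
  have h2 : 2 * w + 2 * c + 10 ≤ D := by nlinarith [mul_nonneg hc0 hw]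
  change 2 * w + 2 * c + 10 ≤ _
  linarith
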